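/- arXiv:1809.10272 — 2 statements merged into one kernel-verified Lean document; each statement's English description precedes it below -/
import Mathlib

section
/- Let X₁, …, Xₙ be finite-valued random variables on a common probability space and let δ > 0. Then there is a subset S ⊆ [n] with |S| ≤ DTC(X₁;…;Xₙ)/δ² such that TC(X₁;…;Xₙ | X_S) + DTC(X₁;…;Xₙ | X_S) ≤ δ²·|[n]∖S|. -/
open MeasureTheory Real

namespace Corr

variable {Ω : Type*} [MeasurableSpace Ω]

/-- Shannon entropy of a finite-valued random variable. -/
noncomputable def shEnt {K : Type*} [Fintype K] (μ : Measure Ω) (X : Ω → K) : ℝ :=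
  ∑ k : K, Real.negMulLog ((μ (X ⁻¹' {k})).toReal)

/-- Conditional Shannon entropy `H(X | Y)`. -/
noncomputable def condEnt {K L : Type*} [Fintype K] [Fintype L]
    (μ : Measure Ω) (X : Ω → K) (Y : Ω → L) : ℝ :=
  shEnt μ (fun ω => (X ω, Y ω)) - shEnt μ Y

/-- Mutual information `I(X ; Y)`. -/
noncomputable def mutInfo {K L : Type*} [Fintype K] [Fintype L]
    (μ : Measure Ω) (X : Ω → K) (Y : Ω → L) : ℝ :=
  shEnt μ X + shEnt μ Y - shEnt μ (fun ω => (X ω, Y ω))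

/-- Conditional mutual information `I(X ; Y | Z)`. -/
noncomputable def condMutInfo {K L M : Type*} [Fintype K] [Fintype L] [Fintype M]
    (μ : Measure Ω) (X : Ω → K) (Y : Ω → L) (Z : Ω → M) : ℝ :=
  condEnt μ X Z + condEnt μ Y Z - condEnt μ (fun ω => (X ω, Y ω)) Z

/-- The joint random variable of a family of random variables. -/
def joint {ι : Type*} {K : ι → Type*} (X : ∀ i, Ω → K i) : Ω → ∀ i, K i :=
  fun ω i => X i ω

/-- Total correlation `TC(X₁;…;Xₙ)`. -/
noncomputable def TC {ι : Type*} [Fintype ι] [DecidableEq ι] {K : ι → Type*}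
    [∀ i, Fintype (K i)] (μ : Measure Ω) (X : ∀ i, Ω → K i) : ℝ :=
  (∑ i, shEnt μ (X i)) - shEnt μ (joint X)

/-- Dual total correlation `DTC(X₁;…;Xₙ)`. -/
noncomputable def DTC {ι : Type*} [Fintype ι] [DecidableEq ι] {K : ι → Type*}
    [∀ i, Fintype (K i)] (μ : Measure Ω) (X : ∀ i, Ω → K i) : ℝ :=
  shEnt μ (joint X) - ∑ i, condEnt μ (X i) (joint fun j : {j : ι // j ≠ i} => X j.1)

/-- Conditional total correlation `TC(X₁;…;Xₙ | Y)`. -/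
noncomputable def condTC {ι : Type*} [Fintype ι] [DecidableEq ι] {K : ι → Type*}
    [∀ i, Fintype (K i)] {L : Type*} [Fintype L]
    (μ : Measure Ω) (X : ∀ i, Ω → K i) (Y : Ω → L) : ℝ :=
  (∑ i, condEnt μ (X i) Y) - condEnt μ (joint X) Y

/-- Conditional dual total correlation `DTC(X₁;…;Xₙ | Y)`. -/
noncomputable def condDTC {ι : Type*} [Fintype ι] [DecidableEq ι] {K : ι → Type*}
    [∀ i, Fintype (K i)] {L : Type*} [Fintype L]
    (μ : Measure Ω) (X : ∀ i, Ω → K i) (Y : Ω → L) : ℝ :=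
  condEnt μ (joint X) Y -
    ∑ i, condEnt μ (X i)
      (fun ω => (joint (fun j : {j : ι // j ≠ i} => X j.1) ω, Y ω))

/-- Submodularity of entropy for a finite table of nonnegative masses. -/
theorem sum_negMulLog_submodular {α β γ : Type*} [Fintype α] [Fintype β] [Fintype γ]
    (p : α → β → γ → ℝ) (hp : ∀ a b c, 0 ≤ p a b c) :
    (∑ a, ∑ b, ∑ c, negMulLog (p a b c)) + ∑ b, negMulLog (∑ a, ∑ c, p a b c) ≤
      (∑ a, ∑ b, negMulLog (∑ c, p a b c)) + ∑ b, ∑ c, negMulLog (∑ a, p a b c) := by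
  set q : α → β → ℝ := fun a b => ∑ c, p a b c with hq
  set s : β → γ → ℝ := fun b c => ∑ a, p a b c with hs
  set r : β → ℝ := fun b => ∑ a, ∑ c, p a b c with hr
  have hq0 : ∀ a b, 0 ≤ q a b := fun a b => Finset.sum_nonneg fun c _ => hp a b c
  have hs0 : ∀ b c, 0 ≤ s b c := fun b c => Finset.sum_nonneg fun a _ => hp a b c
  have hr0 : ∀ b, 0 ≤ r b := fun b => Finset.sum_nonneg fun a _ => hq0 a b
  have hpq : ∀ a b c, p a b c ≤ q a b := fun a b c =>
    Finset.single_le_sum (f := fun c => p a b c) (fun c _ => hp a b c) (Finset.mem_univ c)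
  have hps : ∀ a b c, p a b c ≤ s b c := fun a b c =>
    Finset.single_le_sum (f := fun a => p a b c) (fun a _ => hp a b c) (Finset.mem_univ a)
  have hqr : ∀ a b, q a b ≤ r b := fun a b =>
    Finset.single_le_sum (f := fun a => q a b) (fun a _ => hq0 a b) (Finset.mem_univ a)
  have hsr : ∀ b, ∑ c, s b c = r b := fun b => Finset.sum_comm
  have key : ∀ a b c,
      negMulLog (p a b c) - p a b c * log (r b) + p a b c * log (q a b) +
        p a b c * log (s b c) ≤ q a b * s b c / r b - p a b c := by
    intro a b c
    rcases (hp a b c).eq_or_lt with h | h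
    · rw [← h]
      have : 0 ≤ q a b * s b c / r b :=
        div_nonneg (mul_nonneg (hq0 a b) (hs0 b c)) (hr0 b)
      simpa using this
    · have h1 : 0 < q a b := h.trans_le (hpq a b c)
      have h2 : 0 < s b c := h.trans_le (hps a b c)
      have h3 : 0 < r b := h1.trans_le (hqr a b)
      have hlog := log_le_sub_one_of_pos (x := q a b * s b c / (r b * p a b c)) (by positivity)
      rw [log_div (by positivity) (by positivity), log_mul h1.ne' h2.ne',
        log_mul h3.ne' h.ne'] at hlog
      have hmul := mul_le_mul_of_nonneg_left hlog h.le
      have e : p a b c * (q a b * s b c / (r b * p a b c) - 1) =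
          q a b * s b c / r b - p a b c := by
        field_simp
      rw [e] at hmul
      unfold negMulLog
      linarith
  have hsum := Finset.sum_le_sum fun a (_ : a ∈ Finset.univ) =>
    Finset.sum_le_sum fun b (_ : b ∈ Finset.univ) =>
      Finset.sum_le_sum fun c (_ : c ∈ Finset.univ) => key a b c
  simp only [Finset.sum_add_distrib, Finset.sum_sub_distrib] at hsum
  have e1 : ∑ a, ∑ b, ∑ c, p a b c * log (q a b) = - ∑ a, ∑ b, negMulLog (q a b) := by
    simp only [negMulLog, ← Finset.sum_mul, neg_mul, Finset.sum_neg_distrib, neg_neg, hq]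
  have e2 : ∑ a, ∑ b, ∑ c, p a b c * log (s b c) = - ∑ b, ∑ c, negMulLog (s b c) := by
    rw [Finset.sum_comm]
    simp only [negMulLog, neg_mul, Finset.sum_neg_distrib, neg_neg]
    refine Finset.sum_congr rfl fun b _ => ?_
    rw [Finset.sum_comm]
    simp only [← Finset.sum_mul, hs]
  have e3 : ∑ a, ∑ b, ∑ c, p a b c * log (r b) = - ∑ b, negMulLog (r b) := by
    rw [Finset.sum_comm]
    simp only [negMulLog, ← Finset.sum_mul, neg_mul, Finset.sum_neg_distrib, neg_neg, hr]
  have e4 : ∑ a, ∑ b, ∑ c, q a b * s b c / r b = ∑ a, ∑ b, ∑ c, p a b c := by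
    rw [Finset.sum_comm, Finset.sum_comm (f := fun a b => ∑ c, p a b c)]
    refine Finset.sum_congr rfl fun b _ => ?_
    change _ = r b
    simp only [← Finset.sum_div, ← Finset.mul_sum, ← Finset.sum_mul, hsr]
    exact mul_self_div_self (r b)
  rw [e1, e2, e3, e4] at hsum
  linarith

theorem exists_of_negMulLog_ne_zero {K : Type*} {μ : Measure Ω} {Z : Ω → K} {k : K}
    (hk : negMulLog (μ (Z ⁻¹' {k})).toReal ≠ 0) : ∃ ω, Z ω = k := by
  by_contra! hne
  refine hk ?_
  have : Z ⁻¹' {k} = ∅ := Set.eq_empty_of_forall_notMem hne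
  simp [this]

/-- Entropy depends only on the partition of the sample space that a random variable induces. -/
theorem shEnt_congr {K L : Type*} [Fintype K] [Fintype L] (μ : Measure Ω)
    (X : Ω → K) (Y : Ω → L) (h : ∀ ω ω', X ω = X ω' ↔ Y ω = Y ω') :
    shEnt μ X = shEnt μ Y := by
  have hpre : ∀ ω, X ⁻¹' {X ω} = Y ⁻¹' {Y ω} := fun ω => by
    ext ω'
    exact h ω' ω
  unfold shEnt
  refine Finset.sum_bij_ne_zero (fun k _ hk => Y (exists_of_negMulLog_ne_zero hk).choose)
    (fun _ _ _ => Finset.mem_univ _) ?_ ?_ ?_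
  · intro k _ hk k' _ hk' e
    rw [← (exists_of_negMulLog_ne_zero hk).choose_spec,
      ← (exists_of_negMulLog_ne_zero hk').choose_spec]
    exact (h _ _).2 e
  · intro l _ hl
    obtain ⟨ω, rfl⟩ := exists_of_negMulLog_ne_zero hl
    rw [← hpre] at hl
    exact ⟨X ω, Finset.mem_univ _, hl, (h _ _).1 (exists_of_negMulLog_ne_zero hl).choose_spec⟩
  · intro k _ hk
    rw [← hpre, (exists_of_negMulLog_ne_zero hk).choose_spec]

theorem toReal_measure_eq_sum_fiber {K : Type*} [Fintype K] (μ : Measure Ω) [IsFiniteMeasure μ]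
    (Z : Ω → K) (hZ : ∀ k, MeasurableSet (Z ⁻¹' {k})) {E : Set Ω} :
    (μ E).toReal = ∑ k, (μ (E ∩ Z ⁻¹' {k})).toReal := by
  have := sum_measureReal_preimage_singleton (μ := μ.restrict E) (f := Z) Finset.univ
    (fun k _ => hZ k)
  simp only [Finset.coe_univ, Set.preimage_univ, measureReal_restrict_apply (hZ _),
    measureReal_def, Measure.restrict_apply_univ] at this
  rw [← this]
  simp only [Set.inter_comm]

/-- Submodularity of Shannon entropy. -/
theorem shEnt_submodular {α β γ : Type*} [Fintype α] [Fintype β] [Fintype γ]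
    (μ : Measure Ω) [IsFiniteMeasure μ] (A : Ω → α) (B : Ω → β) (C : Ω → γ)
    (hA : ∀ a, MeasurableSet (A ⁻¹' {a})) (hC : ∀ c, MeasurableSet (C ⁻¹' {c})) :
    shEnt μ (fun ω => (A ω, B ω, C ω)) + shEnt μ B ≤
      shEnt μ (fun ω => (A ω, B ω)) + shEnt μ (fun ω => (B ω, C ω)) := by
  have h := sum_negMulLog_submodular
    (fun a b c => (μ (B ⁻¹' {b} ∩ A ⁻¹' {a} ∩ C ⁻¹' {c})).toReal)
    (fun _ _ _ => ENNReal.toReal_nonneg)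
  simp only [← toReal_measure_eq_sum_fiber μ C hC] at h
  simp only [Set.inter_right_comm _ (A ⁻¹' _) (C ⁻¹' _), ← toReal_measure_eq_sum_fiber μ A hA] at h
  have hABC : ∀ a b c, (fun ω => (A ω, B ω, C ω)) ⁻¹' {(a, b, c)} =
      B ⁻¹' {b} ∩ C ⁻¹' {c} ∩ A ⁻¹' {a} := fun a b c => by
    ext ω
    simp only [Set.mem_preimage, Set.mem_singleton_iff, Set.mem_inter_iff, Prod.mk.injEq]
    tauto
  have hAB : ∀ a b, (fun ω => (A ω, B ω)) ⁻¹' {(a, b)} = B ⁻¹' {b} ∩ A ⁻¹' {a} :=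
    fun a b => by
      ext ω
      simp only [Set.mem_preimage, Set.mem_singleton_iff, Set.mem_inter_iff, Prod.mk.injEq]
      tauto
  have hBC : ∀ b c, (fun ω => (B ω, C ω)) ⁻¹' {(b, c)} = B ⁻¹' {b} ∩ C ⁻¹' {c} :=
    fun b c => by
      ext ω
      simp only [Set.mem_preimage, Set.mem_singleton_iff, Set.mem_inter_iff, Prod.mk.injEq]
  simpa only [shEnt, Fintype.sum_prod_type, hABC, hAB, hBC] using h

/-- If every marginal increment of a set function is at least the increment at the top, then some
set whose size is controlled by the total defect has small total defect in its complement. -/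
theorem exists_finset_sum_increment_le {ι : Type*} [Fintype ι] [DecidableEq ι]
    (h : Finset ι → ℝ)
    (hmono : ∀ S i, i ∉ S →
      h Finset.univ - h (Finset.univ.erase i) ≤ h (insert i S) - h S)
    (ε : ℝ) (hε : 0 < ε) :
    ∃ S : Finset ι,
      (S.card : ℝ) ≤
        (h Finset.univ - h ∅ - ∑ i, (h Finset.univ - h (Finset.univ.erase i))) / ε ∧
      ∑ i ∈ Sᶜ, (h (insert i S) - h S - (h Finset.univ - h (Finset.univ.erase i))) ≤
        ε * (Sᶜ.card : ℝ) := by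
  set m : ι → ℝ := fun i => h Finset.univ - h (Finset.univ.erase i) with hm
  have hlower : ∀ S : Finset ι, h S + ∑ i ∈ Sᶜ, m i ≤ h Finset.univ := by
    intro S
    have aux : ∀ T : Finset ι, Disjoint T S → h S + ∑ i ∈ T, m i ≤ h (T ∪ S) := by
      intro T
      induction T using Finset.induction_on with
      | empty => simp
      | insert i T hi ih =>
        intro hd
        rw [Finset.disjoint_insert_left] at hd
        have h1 := ih hd.2
        have h2 := hmono (T ∪ S) i (by simp [hi, hd.1])
        rw [Finset.sum_insert hi, Finset.insert_union]
        simp only [hm] at h1 ⊢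
        linarith
    simpa only [Finset.union_comm, Finset.union_compl] using aux Sᶜ disjoint_compl_left
  obtain ⟨S, -, hS⟩ := Finset.exists_min_image (Finset.univ : Finset (Finset ι))
    (fun S => ε * (S.card : ℝ) - h S - ∑ i ∈ Sᶜ, m i) Finset.univ_nonempty
  refine ⟨S, ?_, ?_⟩
  · rw [le_div_iff₀ hε]
    have h1 := hS ∅ (Finset.mem_univ _)
    have h2 := hlower S
    simp only [Finset.card_empty, Nat.cast_zero, mul_zero, Finset.compl_empty] at h1
    linarith
  · rw [mul_comm, ← nsmul_eq_mul]
    refine Finset.sum_le_card_nsmul _ _ _ fun i hi => ?_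
    have h1 := hS (insert i S) (Finset.mem_univ _)
    rw [Finset.mem_compl] at hi
    simp only [Finset.card_insert_of_notMem hi, Nat.cast_add, Nat.cast_one,
      Finset.compl_insert] at h1
    have h2 := Finset.add_sum_erase Sᶜ m (Finset.mem_compl.2 hi)
    change _ - m i ≤ ε
    linarith

/-- For finite-valued `X₁, …, Xₙ` and `δ > 0`, there is `S ⊆ [n]` with
`|S| ≤ DTC(X₁;…;Xₙ)/δ²` such that
`TC(X₁;…;Xₙ | X_S) + DTC(X₁;…;Xₙ | X_S) ≤ δ²·|[n]∖S|`. -/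
theorem exists_good_conditioning_set (μ : Measure Ω) [IsProbabilityMeasure μ]
    {n : ℕ} {K : Fin n → Type*} [∀ i, Fintype (K i)]
    [∀ i, MeasurableSpace (K i)] [∀ i, MeasurableSingletonClass (K i)]
    (X : ∀ i, Ω → K i) (hX : ∀ i, Measurable (X i))
    (δ : ℝ) (hδ : 0 < δ) :
    ∃ S : Finset (Fin n), (S.card : ℝ) ≤ DTC μ X / δ ^ 2 ∧
      condTC μ X (joint fun i : {x : Fin n // x ∈ S} => X i.1) +
        condDTC μ X (joint fun i : {x : Fin n // x ∈ S} => X i.1) ≤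
      δ ^ 2 * (Sᶜ.card : ℝ) := by
  classical
  set h : Finset (Fin n) → ℝ := fun S => shEnt μ (joint fun i : {x : Fin n // x ∈ S} => X i.1)
    with hh
  have joint_eq : ∀ (p : Fin n → Prop) ω ω',
      (joint fun j : {x : Fin n // p x} => X j.1) ω = (joint fun j : {x : Fin n // p x} => X j.1) ω'
        ↔ ∀ j, p j → X j ω = X j ω' := by
    intro p ω ω'
    simp [joint, funext_iff]
  have huniv : shEnt μ (joint X) = h Finset.univ := by
    refine shEnt_congr μ _ _ fun ω ω' => ?_
    rw [joint_eq (· ∈ Finset.univ)]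
    simp [joint, funext_iff]
  have hempty : h ∅ = 0 := by
    have : ∀ k, (joint fun i : {x : Fin n // x ∈ (∅ : Finset (Fin n))} => X i.1) ⁻¹' {k} =
        Set.univ := fun k => by
      ext ω
      simpa using Subsingleton.elim _ _
    simp [hh, shEnt, this]
  have hinsert : ∀ i (S : Finset (Fin n)),
      shEnt μ (fun ω => (X i ω, (joint fun j : {x : Fin n // x ∈ S} => X j.1) ω)) =
        h (insert i S) := by
    intro i S
    refine shEnt_congr μ _ _ fun ω ω' => ?_
    rw [joint_eq (· ∈ insert i S), Prod.mk.injEq, joint_eq (· ∈ S)]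
    simp
  have herase : ∀ i, shEnt μ (joint fun j : {j : Fin n // j ≠ i} => X j.1) =
      h (Finset.univ.erase i) := by
    intro i
    refine shEnt_congr μ _ _ fun ω ω' => ?_
    rw [joint_eq (· ∈ Finset.univ.erase i), joint_eq (· ≠ i)]
    simp
  have hmeas : ∀ (p : Fin n → Prop) k,
      MeasurableSet ((joint fun j : {x : Fin n // p x} => X j.1) ⁻¹' {k}) := by
    intro p k
    have : (joint fun j : {x : Fin n // p x} => X j.1) ⁻¹' {k} =
        ⋂ j : {x : Fin n // p x}, X j.1 ⁻¹' {k j} := by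
      ext ω
      simp [joint, funext_iff]
    rw [this]
    exact MeasurableSet.iInter fun j => hX j.1 (measurableSet_singleton _)
  have hmono : ∀ S i, i ∉ S →
      h Finset.univ - h (Finset.univ.erase i) ≤ h (insert i S) - h S := by
    intro S i hi
    have key := shEnt_submodular μ (X i) (joint fun j : {x : Fin n // x ∈ S} => X j.1)
      (joint fun j : {j : Fin n // j ≠ i} => X j.1)
      (fun a => hX i (measurableSet_singleton a)) (hmeas (· ≠ i))
    have hne : ∀ j ∈ S, j ≠ i := fun j hj e => hi (e ▸ hj)
    rw [hinsert, shEnt_congr μ (fun ω => (X i ω, (joint fun j : {x : Fin n // x ∈ S} => X j.1) ω,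
        (joint fun j : {j : Fin n // j ≠ i} => X j.1) ω)) (joint X) ?_,
      shEnt_congr μ (fun ω => ((joint fun j : {x : Fin n // x ∈ S} => X j.1) ω,
        (joint fun j : {j : Fin n // j ≠ i} => X j.1) ω))
        (joint fun j : {j : Fin n // j ≠ i} => X j.1) ?_, huniv, herase] at key
    · change h Finset.univ + h S ≤ _ at key
      linarith
    · intro ω ω'
      rw [Prod.mk.injEq, joint_eq (· ∈ S), joint_eq (· ≠ i)]
      exact ⟨And.right, fun H => ⟨fun j hj => H j (hne j hj), H⟩⟩
    · intro ω ω'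
      rw [Prod.mk.injEq, Prod.mk.injEq, joint_eq (· ∈ S), joint_eq (· ≠ i)]
      simp only [joint, funext_iff]
      refine ⟨fun H j => ?_, fun H => ⟨H i, fun j _ => H j, fun j _ => H j⟩⟩
      by_cases hj : j = i
      · exact hj ▸ H.1
      · exact H.2.2 j hj
  have hpair : ∀ i, shEnt μ (fun ω => (X i ω, (joint fun j : {j : Fin n // j ≠ i} => X j.1) ω)) =
      h Finset.univ := by
    intro i
    rw [← huniv]
    refine shEnt_congr μ _ _ fun ω ω' => ?_
    rw [Prod.mk.injEq, joint_eq (· ≠ i)]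
    simp only [joint, funext_iff]
    refine ⟨fun H j => ?_, fun H => ⟨H i, fun j _ => H j⟩⟩
    by_cases hj : j = i
    · exact hj ▸ H.1
    · exact H.2 j hj
  obtain ⟨S, hcard, hsum⟩ := exists_finset_sum_increment_le h hmono (δ ^ 2) (by positivity)
  refine ⟨S, ?_, le_of_eq_of_le ?_ hsum⟩
  · have hDTC : DTC μ X = h Finset.univ - h ∅ -
        ∑ i, (h Finset.univ - h (Finset.univ.erase i)) := by
      simp only [DTC, condEnt, huniv, hpair, herase, hempty, sub_zero]
    rwa [hDTC]
  · have hcond : ∀ i, shEnt μ (fun ω => (joint (fun j : {j : Fin n // j ≠ i} => X j.1) ω,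
        (joint fun j : {x : Fin n // x ∈ S} => X j.1) ω)) = h (Finset.univ.erase i ∪ S) := by
      intro i
      refine shEnt_congr μ _ _ fun ω ω' => ?_
      rw [Prod.mk.injEq, joint_eq (· ∈ Finset.univ.erase i ∪ S), joint_eq (· ≠ i),
        joint_eq (· ∈ S)]
      simp only [Finset.mem_union, Finset.mem_erase, Finset.mem_univ, and_true, or_imp,
        forall_and]
    have htriple : ∀ i, shEnt μ (fun ω => (X i ω, joint (fun j : {j : Fin n // j ≠ i} => X j.1) ω,
        (joint fun j : {x : Fin n // x ∈ S} => X j.1) ω)) = h Finset.univ := by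
      intro i
      rw [← hpair i]
      refine shEnt_congr μ _ _ fun ω ω' => ?_
      rw [Prod.mk.injEq, Prod.mk.injEq, Prod.mk.injEq, joint_eq (· ≠ i), joint_eq (· ∈ S)]
      refine ⟨fun H => ⟨H.1, H.2.1⟩, fun H => ⟨H.1, H.2, fun j _ => ?_⟩⟩
      by_cases hj : j = i
      · exact hj ▸ H.1
      · exact H.2 j hj
    have hsplit : condTC μ X (joint fun i : {x : Fin n // x ∈ S} => X i.1) +
        condDTC μ X (joint fun i : {x : Fin n // x ∈ S} => X i.1) =
        ∑ i, (h (insert i S) - h S - (h Finset.univ - h (Finset.univ.erase i ∪ S))) := by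
      simp only [condTC, condDTC]
      rw [sub_add_sub_cancel, ← Finset.sum_sub_distrib]
      refine Finset.sum_congr rfl fun i _ => ?_
      simp only [condEnt, hinsert, hcond, htriple]
      rfl
    rw [hsplit, ← Finset.sum_compl_add_sum S, Finset.sum_eq_zero (s := S), add_zero]
    · refine Finset.sum_congr rfl fun i hi => ?_
      rw [Finset.mem_compl] at hi
      have hS : S ⊆ Finset.univ.erase i := Finset.subset_erase.2 ⟨Finset.subset_univ S, hi⟩
      rw [Finset.union_eq_left.2 hS]
    · intro i hi
      have : Finset.univ.erase i ∪ S = Finset.univ := by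
        ext j
        by_cases hj : j = i <;> simp [hj, hi]
      rw [Finset.insert_eq_of_mem hi, this]
      simp

end Corr
end

section
/- Let K₁, …, Kₙ be non-empty finite sets, each of cardinality at most k, equip ∏_{i=1}^n Kᵢ with the normalized Hamming metric d_n(x,y) := (1/n)·|{i : xᵢ ≠ yᵢ}|, fix δ > 0, and let μ be a probability measure on ∏ᵢ Kᵢ. Then μ may be written as a finite mixture μ = p₁μ₁ + ⋯ + p_mμ_m (with p_j ≥ 0, ∑_j p_j = 1, each μ_j a probability measure on ∏ᵢ Kᵢ) such that: (a) m ≤ k^{DTC(μ)/δ²}; and (b) there exist product probability measures ξ₁, …, ξ_m on ∏ᵢ Kᵢ and couplings λ_j of μ_j and ξ_j with ∑_{j=1}^m p_j · ∫ d_n(x,y) λ_j(dx,dy) < δ. -/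
open MeasureTheory Real

namespace Corr

variable {Ω : Type*} [MeasurableSpace Ω]

/-- The normalized Hamming distance `d_n(x,y) = |{i : xᵢ ≠ yᵢ}| / n` on `∏ i, K i`. -/
noncomputable def hammingDist {n : ℕ} {K : Fin n → Type*} [∀ i, DecidableEq (K i)]
    (x y : ∀ i, K i) : ℝ :=
  ((Finset.univ.filter fun i => x i ≠ y i).card : ℝ) / n

open scoped ENNReal NNReal

section FiniteWeights

variable {α β L M : Type*} [Fintype α] [Fintype β] [DecidableEq β] [DecidableEq L] [DecidableEq M]

/-- The total weight of the fibre of `T` through `x`. -/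
noncomputable def fiberWeight (w : α → ℝ) (T : α → L) (x : α) : ℝ :=
  ∑ u with T u = T x, w u

/-- The conditional distribution of `X` given `T = T x`, for the weights `w`. -/
noncomputable def condWeight (w : α → ℝ) (X : α → β) (T : α → L) (x : α) (b : β) : ℝ :=
  (∑ x' with T x' = T x ∧ X x' = b, w x') / fiberWeight w T x

/-- The Shannon entropy of `T` for the weights `w`. -/
noncomputable def weightEnt (w : α → ℝ) (T : α → L) : ℝ :=
  -∑ x, w x * Real.log (fiberWeight w T x)

lemma fiberWeight_congr {w : α → ℝ} {T : α → L} {T' : α → M}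
    (h : ∀ x x', T x = T x' ↔ T' x = T' x') (x : α) : fiberWeight w T x = fiberWeight w T' x := by
  simp only [fiberWeight, h]

lemma weightEnt_congr {w : α → ℝ} {T : α → L} {T' : α → M}
    (h : ∀ x x', T x = T x' ↔ T' x = T' x') : weightEnt w T = weightEnt w T' := by
  simp only [weightEnt, fiberWeight_congr h]

lemma fiberWeight_eq_of_eq {w : α → ℝ} {T : α → L} {x x' : α} (h : T x = T x') :
    fiberWeight w T x = fiberWeight w T x' := by
  simp only [fiberWeight, h]

omit [Fintype β] in
lemma condWeight_eq_of_eq {w : α → ℝ} {X : α → β} {T : α → L} {x x' : α} (h : T x = T x') :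
    condWeight w X T x = condWeight w X T x' := by
  funext b
  simp only [condWeight, fiberWeight, h]

lemma le_fiberWeight {w : α → ℝ} (hw : ∀ x, 0 ≤ w x) (T : α → L) (x : α) :
    w x ≤ fiberWeight w T x :=
  Finset.single_le_sum (f := w) (fun i _ => hw i) (by simp)

lemma fiberWeight_nonneg {w : α → ℝ} (hw : ∀ x, 0 ≤ w x) (T : α → L) (x : α) :
    0 ≤ fiberWeight w T x :=
  Finset.sum_nonneg fun i _ => hw i

omit [Fintype β] in
lemma condWeight_nonneg {w : α → ℝ} (hw : ∀ x, 0 ≤ w x) (X : α → β) (T : α → L) (x : α) (b : β) :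
    0 ≤ condWeight w X T x b :=
  div_nonneg (Finset.sum_nonneg fun i _ => hw i) (fiberWeight_nonneg hw T x)

lemma sum_condWeight_mul (w : α → ℝ) (X : α → β) (T : α → L) (x : α) (f : β → ℝ) :
    ∑ b, condWeight w X T x b * f b =
      (∑ x' with T x' = T x, w x' * f (X x')) / fiberWeight w T x := by
  have h : ∀ b, condWeight w X T x b * f b =
      (∑ x' with T x' = T x, if X x' = b then w x' * f (X x') else 0) / fiberWeight w T x := by
    intro b
    rw [condWeight, div_mul_eq_mul_div, Finset.sum_mul, ← Finset.filter_filter,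
      Finset.sum_filter (fun x' => X x' = b)]
    congr 1
    refine Finset.sum_congr rfl fun x' _ => ?_
    split_ifs with h
    · rw [h]
    · rfl
  rw [Finset.sum_congr rfl fun b _ => h b, ← Finset.sum_div, Finset.sum_comm]
  simp

lemma sum_condWeight {w : α → ℝ} (X : α → β) (T : α → L) {x : α} (hx : 0 < fiberWeight w T x) :
    ∑ b, condWeight w X T x b = 1 := by
  have h := sum_condWeight_mul w X T x fun _ => 1
  simp only [mul_one] at h
  rw [h]
  exact div_self hx.ne'

omit [Fintype β] in
lemma condWeight_self (w : α → ℝ) (X : α → β) (T : α → L) (x : α) :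
    condWeight w X T x (X x) =
      fiberWeight w (fun x' => (X x', T x')) x / fiberWeight w T x := by
  simp only [condWeight, fiberWeight, Prod.mk.injEq, and_comm]

/-- Averaging over `X` given `T` does not change the expectation of a function of `T` and `X`. -/
lemma sum_mul_eq_sum_condWeight {w : α → ℝ} (hw : ∀ x, 0 ≤ w x) (X : α → β) (T : α → L)
    (F : α → β → ℝ) (hF : ∀ x x', T x = T x' → F x = F x') :
    ∑ x, w x * F x (X x) = ∑ x, w x * ∑ b, condWeight w X T x b * F x b := by
  have h1 : ∀ x, w x * ∑ b, condWeight w X T x b * F x b =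
      ∑ x', if T x' = T x then w x * (w x' * F x' (X x') / fiberWeight w T x') else 0 := by
    intro x
    rw [sum_condWeight_mul, Finset.sum_div, Finset.mul_sum, ← Finset.sum_filter]
    refine Finset.sum_congr rfl fun x' hx' => ?_
    have hx' : T x' = T x := by simpa using hx'
    rw [hF x' x hx', fiberWeight_eq_of_eq hx']
  rw [Finset.sum_congr rfl fun x _ => h1 x, Finset.sum_comm]
  refine Finset.sum_congr rfl fun x' _ => ?_
  have h2 : ∑ x, (if T x' = T x then w x * (w x' * F x' (X x') / fiberWeight w T x') else 0) =
      fiberWeight w T x' * (w x' * F x' (X x') / fiberWeight w T x') := by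
    rw [fiberWeight, Finset.sum_mul, ← Finset.sum_filter]
    simp only [eq_comm]
  rw [h2]
  rcases (hw x').eq_or_lt with h0 | h0
  · simp [← h0]
  · have := h0.trans_le (le_fiberWeight hw T x')
    field_simp

/-- The relative entropy of two finite weights. -/
noncomputable def relEnt (p q : β → ℝ) : ℝ := ∑ b, p b * Real.log (p b / q b)

omit [DecidableEq β] in
/-- A weak form of Pinsker's inequality. -/
lemma sq_sum_sub_min_le_relEnt {p q : β → ℝ} (hp : ∀ b, 0 ≤ p b) (hq : ∀ b, 0 ≤ q b)
    (hp1 : ∑ b, p b = 1) (hq1 : ∑ b, q b = 1) (hpq : ∀ b, q b = 0 → p b = 0) :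
    (∑ b, (p b - min (p b) (q b))) ^ 2 ≤ relEnt p q := by
  have hterm : ∀ b, 2 * (p b - √(p b * q b)) ≤ p b * Real.log (p b / q b) := by
    intro b
    rcases (hp b).eq_or_lt with h | h
    · simp [← h]
    · have hqb : 0 < q b := (hq b).lt_of_ne fun h' => h.ne' (hpq b h'.symm)
      have h1 := Real.log_le_sub_one_of_pos (Real.sqrt_pos.2 (div_pos hqb h))
      rw [Real.log_sqrt (div_pos hqb h).le] at h1
      have h2 : Real.log (p b / q b) = -Real.log (q b / p b) := by
        rw [← Real.log_inv, inv_div]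
      have h3 : p b * √(q b / p b) = √(p b * q b) := by
        rw [Real.sqrt_div' _ h.le, Real.sqrt_mul h.le]
        have h4 := Real.mul_self_sqrt h.le
        have h5 := Real.sqrt_pos.2 h
        field_simp
        rw [sq, h4]
      rw [h2, ← h3]
      nlinarith
  have hkl : 2 * (1 - ∑ b, √(p b * q b)) ≤ relEnt p q := by
    have h := Finset.sum_le_sum fun b (_ : b ∈ Finset.univ) => hterm b
    rwa [← Finset.mul_sum, Finset.sum_sub_distrib, hp1] at h
  have hcs : (∑ b, √(p b * q b)) ^ 2 ≤ (∑ b, min (p b) (q b)) * ∑ b, max (p b) (q b) := by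
    refine Finset.sum_sq_le_sum_mul_sum_of_sq_le_mul _ (fun b _ => le_min (hp b) (hq b))
      (fun b _ => le_max_of_le_left (hp b)) fun b _ => ?_
    exact (by rw [Real.sq_sqrt (mul_nonneg (hp b) (hq b)), min_mul_max] : _ = _).le
  have hmax : ∑ b, max (p b) (q b) = 2 - ∑ b, min (p b) (q b) := by
    rw [eq_sub_iff_add_eq, ← Finset.sum_add_distrib]
    simp only [max_add_min, Finset.sum_add_distrib, hp1, hq1]
    norm_num
  rw [Finset.sum_sub_distrib, hp1]
  rw [hmax] at hcs
  nlinarith [sq_nonneg (1 - ∑ b, √(p b * q b))]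

/-- The average relative entropy between the conditional laws of `X` given a fine variable `Y`
and a coarse variable `Z` is a difference of conditional entropies. -/
lemma sum_mul_relEnt_condWeight {w : α → ℝ} (hw : ∀ x, 0 ≤ w x) (X : α → β) {Y : α → M}
    {Z : α → L} (hYZ : ∀ x x', Y x = Y x' → Z x = Z x') :
    ∑ x, w x * relEnt (condWeight w X Y x) (condWeight w X Z x) =
      (weightEnt w (fun x => (X x, Z x)) - weightEnt w Z) -
        (weightEnt w (fun x => (X x, Y x)) - weightEnt w Y) := by
  have h := sum_mul_eq_sum_condWeight hw X Y
    (fun x b => Real.log (condWeight w X Y x b / condWeight w X Z x b)) (by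
      intro x x' hx
      simp only [condWeight_eq_of_eq (X := X) hx, condWeight_eq_of_eq (X := X) (hYZ x x' hx)])
  simp only [relEnt]
  rw [← h]
  simp only [weightEnt, sub_neg_eq_add, ← Finset.sum_neg_distrib,
    ← Finset.sum_sub_distrib]
  refine Finset.sum_congr rfl fun x _ => ?_
  rcases (hw x).eq_or_lt with h0 | h0
  · simp [← h0]
  · have h1 := (h0.trans_le (le_fiberWeight hw Y x)).ne'
    have h2 := (h0.trans_le (le_fiberWeight hw Z x)).ne'
    have h3 := (h0.trans_le (le_fiberWeight hw (fun x => (X x, Y x)) x)).ne'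
    have h4 := (h0.trans_le (le_fiberWeight hw (fun x => (X x, Z x)) x)).ne'
    rw [condWeight_self, condWeight_self, Real.log_div (div_ne_zero h3 h1) (div_ne_zero h4 h2),
      Real.log_div h3 h1, Real.log_div h4 h2]
    ring

omit [Fintype β] in
lemma condWeight_eq_zero_of_coarse {w : α → ℝ} (hw : ∀ x, 0 ≤ w x) (X : α → β) {Y : α → M}
    {Z : α → L} (hYZ : ∀ x x', Y x = Y x' → Z x = Z x') {x : α} (hx : 0 < w x) {b : β}
    (h : condWeight w X Z x b = 0) : condWeight w X Y x b = 0 := by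
  have h2 := (hx.trans_le (le_fiberWeight hw Z x)).ne'
  rw [condWeight, div_eq_zero_iff, or_iff_left h2,
    Finset.sum_eq_zero_iff_of_nonneg fun i _ => hw i] at h
  rw [condWeight, Finset.sum_eq_zero, zero_div]
  intro x' hx'
  obtain ⟨hY, hX⟩ : Y x' = Y x ∧ X x' = b := by simpa using hx'
  exact h x' (by simpa using ⟨hYZ _ _ hY, hX⟩)

/-- The total variation distance between the conditional laws of `X` given a fine variable `Y`
and a coarse variable `Z` is on average controlled by the entropy drop. -/
lemma sq_sum_condWeight_sub_min_le {w : α → ℝ} (hw : ∀ x, 0 ≤ w x) (hw1 : ∑ x, w x = 1)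
    (X : α → β) {Y : α → M} {Z : α → L} (hYZ : ∀ x x', Y x = Y x' → Z x = Z x') :
    (∑ x, w x * ∑ b, (condWeight w X Y x b -
        min (condWeight w X Y x b) (condWeight w X Z x b))) ^ 2 ≤
      (weightEnt w (fun x => (X x, Z x)) - weightEnt w Z) -
        (weightEnt w (fun x => (X x, Y x)) - weightEnt w Y) := by
  rw [← sum_mul_relEnt_condWeight hw X hYZ]
  set t : α → ℝ := fun x => ∑ b, (condWeight w X Y x b -
        min (condWeight w X Y x b) (condWeight w X Z x b)) with ht
  calc (∑ x, w x * t x) ^ 2 ≤ (∑ x, w x) * ∑ x, w x * t x ^ 2 :=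
        Finset.sum_sq_le_sum_mul_sum_of_sq_le_mul _ (fun x _ => hw x)
          (fun x _ => mul_nonneg (hw x) (sq_nonneg _)) fun x _ => le_of_eq (by ring)
    _ = ∑ x, w x * t x ^ 2 := by rw [hw1, one_mul]
    _ ≤ _ := by
        refine Finset.sum_le_sum fun x _ => ?_
        rcases (hw x).eq_or_lt with h0 | h0
        · simp [← h0]
        · refine mul_le_mul_of_nonneg_left ?_ (hw x)
          exact sq_sum_sub_min_le_relEnt (condWeight_nonneg hw X Y x)
            (condWeight_nonneg hw X Z x) (sum_condWeight X Y (h0.trans_le (le_fiberWeight hw Y x)))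
            (sum_condWeight X Z (h0.trans_le (le_fiberWeight hw Z x)))
            fun b => condWeight_eq_zero_of_coarse hw X hYZ h0

/-- The transition kernel of the optimal coupling of `p` and `q`. -/
noncomputable def couplingKernel (p q : β → ℝ) (a b : β) : ℝ :=
  let r : ℝ := if p a = 0 then 1 else min (p a) (q a) / p a
  let t : ℝ := ∑ c, (p c - min (p c) (q c))
  (if a = b then r else 0) + (1 - r) * (if t = 0 then q b else (q b - min (p b) (q b)) / t)

section couplingKernel

variable {p q : β → ℝ} (hp : ∀ b, 0 ≤ p b) (hq : ∀ b, 0 ≤ q b)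
  (hp1 : ∑ b, p b = 1) (hq1 : ∑ b, q b = 1)

include hp hq in
lemma couplingKernel_nonneg (a b : β) : 0 ≤ couplingKernel p q a b := by
  have hr0 : 0 ≤ (if p a = 0 then 1 else min (p a) (q a) / p a : ℝ) := by
    split_ifs
    · exact zero_le_one
    · exact div_nonneg (le_min (hp a) (hq a)) (hp a)
  have hr1 : (if p a = 0 then 1 else min (p a) (q a) / p a : ℝ) ≤ 1 := by
    split_ifs
    · exact le_rfl
    · exact div_le_one_of_le₀ (min_le_left _ _) (hp a)
  have ht : 0 ≤ ∑ c, (p c - min (p c) (q c)) :=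
    Finset.sum_nonneg fun c _ => sub_nonneg.2 (min_le_left _ _)
  refine add_nonneg ?_ (mul_nonneg (sub_nonneg.2 hr1) ?_)
  · split_ifs <;> simp_all
  · split_ifs
    · exact hq b
    · exact div_nonneg (sub_nonneg.2 (min_le_right _ _)) ht

include hp1 hq1 in
lemma sum_couplingKernel (a : β) : ∑ b, couplingKernel p q a b = 1 := by
  simp only [couplingKernel, Finset.sum_add_distrib, ← Finset.mul_sum]
  have h : (∑ b, if ∑ c, (p c - min (p c) (q c)) = 0 then q b
      else (q b - min (p b) (q b)) / ∑ c, (p c - min (p c) (q c))) = 1 := by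
    split_ifs with ht
    · exact hq1
    · rw [← Finset.sum_div, div_eq_one_iff_eq ht, Finset.sum_sub_distrib, Finset.sum_sub_distrib,
        hp1, hq1]
  rw [h]
  simp

include hq hp1 hq1 in
lemma sum_mul_couplingKernel (b : β) : ∑ a, p a * couplingKernel p q a b = q b := by
  have hr : ∀ a, p a * (if p a = 0 then 1 else min (p a) (q a) / p a) = min (p a) (q a) := by
    intro a
    split_ifs with h
    · simp [h, hq a]
    · field_simp
  have h : ∀ a, p a * couplingKernel p q a b = (if a = b then min (p a) (q a) else 0) +
      (p a - min (p a) (q a)) * (if ∑ c, (p c - min (p c) (q c)) = 0 then q b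
        else (q b - min (p b) (q b)) / ∑ c, (p c - min (p c) (q c))) := by
    intro a
    rw [couplingKernel, mul_add, mul_ite, hr, mul_zero, ← mul_assoc, mul_sub, hr, mul_one]
  rw [Finset.sum_congr rfl fun a _ => h a, Finset.sum_add_distrib, ← Finset.sum_mul]
  have hs : ∑ c, (p c - min (p c) (q c)) = ∑ c, (q c - min (p c) (q c)) := by
    rw [Finset.sum_sub_distrib, Finset.sum_sub_distrib, hp1, hq1]
  split_ifs with ht
  · rw [hs, Finset.sum_eq_zero_iff_of_nonneg fun c _ => sub_nonneg.2 (min_le_right _ _)] at ht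
    have := ht b (Finset.mem_univ b)
    simp only [Finset.sum_ite_eq', Finset.mem_univ, if_true, hs, Finset.sum_eq_zero ht]
    linarith
  · rw [mul_div_cancel₀ _ ht]
    simp

include hp hq in
lemma sum_mul_one_sub_couplingKernel_le :
    ∑ a, p a * (1 - couplingKernel p q a a) ≤ ∑ a, (p a - min (p a) (q a)) := by
  refine Finset.sum_le_sum fun a _ => ?_
  have hr : p a * (if p a = 0 then 1 else min (p a) (q a) / p a) = min (p a) (q a) := by
    split_ifs with h
    · simp [h, hq a]
    · field_simp
  have hr1 : (if p a = 0 then 1 else min (p a) (q a) / p a : ℝ) ≤ 1 := by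
    split_ifs
    · exact le_rfl
    · exact div_le_one_of_le₀ (min_le_left _ _) (hp a)
  have ht : 0 ≤ ∑ c, (p c - min (p c) (q c)) :=
    Finset.sum_nonneg fun c _ => sub_nonneg.2 (min_le_left _ _)
  have hs : 0 ≤ (if ∑ c, (p c - min (p c) (q c)) = 0 then q a
        else (q a - min (p a) (q a)) / ∑ c, (p c - min (p c) (q c))) := by
    split_ifs
    · exact hq a
    · exact div_nonneg (sub_nonneg.2 (min_le_right _ _)) ht
  rw [mul_sub, mul_one]
  refine sub_le_sub_left ?_ _
  rw [couplingKernel, if_pos rfl, mul_add, hr]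
  exact le_add_of_nonneg_right (mul_nonneg (hp a) (mul_nonneg (sub_nonneg.2 hr1) hs))

end couplingKernel

end FiniteWeights
section Entropy

variable {α L : Type*} [Fintype α] [MeasurableSpace α] [MeasurableSingletonClass α]
  [Fintype L] [DecidableEq L]

lemma shEnt_eq_weightEnt (μ : Measure α) [IsProbabilityMeasure μ] (T : α → L) :
    shEnt μ T = weightEnt (fun x => μ.real {x}) T := by
  have h : ∀ k, (μ (T ⁻¹' {k})).toReal = ∑ x with T x = k, μ.real {x} := by
    intro k
    rw [sum_measureReal_singleton, measureReal_def]
    congr 2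
    ext x
    simp
  simp only [shEnt, weightEnt, h, Real.negMulLog, neg_mul, Finset.sum_neg_distrib]
  rw [← Finset.sum_fiberwise Finset.univ T]
  congr 1
  refine Finset.sum_congr rfl fun k _ => ?_
  rw [Finset.sum_mul]
  refine Finset.sum_congr rfl fun x hx => ?_
  have hx : T x = k := by simpa using hx
  simp only [fiberWeight, hx]

end Entropy

section Coordinates

variable {n : ℕ} {K : Fin n → Type*} [∀ i, Fintype (K i)] [∀ i, DecidableEq (K i)]

omit [∀ i, Fintype (K i)] [∀ i, DecidableEq (K i)] in
lemma restrict_eq_restrict_iff {A : Finset (Fin n)} {x x' : ∀ i, K i} :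
    A.restrict x = A.restrict x' ↔ ∀ i ∈ A, x i = x' i := by
  simp [funext_iff, Finset.restrict]

/-- The entropy of the coordinates in `A`, for weights `w` on a finite product. -/
noncomputable def coordEnt (w : (∀ i, K i) → ℝ) (A : Finset (Fin n)) : ℝ :=
  weightEnt w fun x : ∀ i, K i => A.restrict x

/-- The entropy of the coordinates in `S`, minus the entropies of these coordinates conditioned
on all the others. -/
noncomputable def excessEnt (w : (∀ i, K i) → ℝ) (S : Finset (Fin n)) : ℝ :=
  coordEnt w S - ∑ i ∈ S, (coordEnt w Finset.univ - coordEnt w (Finset.univ.erase i))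

variable {w : (∀ i, K i) → ℝ}

lemma weightEnt_pair_restrict (w : (∀ i, K i) → ℝ) (i : Fin n) (A : Finset (Fin n)) :
    weightEnt w (fun x => (x i, A.restrict x)) = coordEnt w (insert i A) := by
  refine weightEnt_congr fun x x' => ?_
  simp [restrict_eq_restrict_iff]

/-- Conditioning on more coordinates reduces entropy. -/
lemma coordEnt_insert_sub_le (hw : ∀ x, 0 ≤ w x) (hw1 : ∑ x, w x = 1) {A B : Finset (Fin n)}
    (hAB : A ⊆ B) (i : Fin n) :
    coordEnt w (insert i B) - coordEnt w B ≤ coordEnt w (insert i A) - coordEnt w A := by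
  have h := (sq_nonneg _).trans (sq_sum_condWeight_sub_min_le hw hw1 (fun x => x i)
    (Y := fun x => B.restrict x) (Z := fun x => A.restrict x) fun x x' h => by
      rw [restrict_eq_restrict_iff] at h ⊢
      exact fun j hj => h j (hAB hj))
  rw [weightEnt_pair_restrict, weightEnt_pair_restrict] at h
  exact sub_nonneg.1 h

lemma coordEnt_empty (hw1 : ∑ x, w x = 1) : coordEnt w ∅ = 0 := by
  have h : ∀ x : ∀ i, K i, fiberWeight w (fun x : ∀ i, K i => Finset.restrict ∅ x) x = 1 := by
    intro x
    rw [fiberWeight, ← hw1]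
    congr 1
    ext x'
    simp [restrict_eq_restrict_iff]
  simp [coordEnt, weightEnt, h]

lemma excessEnt_empty (hw1 : ∑ x, w x = 1) : excessEnt w ∅ = 0 := by
  simp [excessEnt, coordEnt_empty hw1]

lemma excessEnt_insert {S : Finset (Fin n)} {i : Fin n} (hi : i ∉ S) :
    excessEnt w (insert i S) = excessEnt w S + ((coordEnt w (insert i S) - coordEnt w S) -
      (coordEnt w Finset.univ - coordEnt w (Finset.univ.erase i))) := by
  rw [excessEnt, excessEnt, Finset.sum_insert hi]
  ring

lemma excessEnt_le_insert (hw : ∀ x, 0 ≤ w x) (hw1 : ∑ x, w x = 1) (S : Finset (Fin n))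
    (i : Fin n) : excessEnt w S ≤ excessEnt w (insert i S) := by
  by_cases hi : i ∈ S
  · rw [Finset.insert_eq_of_mem hi]
  · rw [excessEnt_insert hi]
    have h := coordEnt_insert_sub_le hw hw1
      (show S ⊆ Finset.univ.erase i from fun j hj => by
        simpa using ne_of_mem_of_not_mem hj hi) i
    rw [Finset.insert_erase (Finset.mem_univ i)] at h
    linarith

lemma excessEnt_le_univ (hw : ∀ x, 0 ≤ w x) (hw1 : ∑ x, w x = 1) (S : Finset (Fin n)) :
    excessEnt w S ≤ excessEnt w Finset.univ := by
  have h : ∀ T : Finset (Fin n), excessEnt w S ≤ excessEnt w (S ∪ T) := by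
    intro T
    induction T using Finset.induction_on with
    | empty => rw [Finset.union_empty]
    | insert i T _ ih =>
      rw [Finset.union_insert]
      exact ih.trans (excessEnt_le_insert hw hw1 _ i)
  simpa only [Finset.union_eq_right.2 (Finset.subset_univ S)] using h Finset.univ

/-- There is a small set of coordinates such that, conditionally on it, no further coordinate
depends much on the coordinates before it. -/
lemma exists_finset_coordEnt_sub_lt (hw : ∀ x, 0 ≤ w x) (hw1 : ∑ x, w x = 1) {ε : ℝ}
    (hε : 0 < ε) :
    ∃ S : Finset (Fin n), S.card * ε ≤ excessEnt w Finset.univ ∧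
      ∀ i, (coordEnt w (insert i S) - coordEnt w S) -
        (coordEnt w (insert i (S ∪ Finset.Iio i)) - coordEnt w (S ∪ Finset.Iio i)) < ε := by
  obtain ⟨S, hS, hmax⟩ := Finset.exists_max_image
    (Finset.univ.filter fun S : Finset (Fin n) => S.card * ε ≤ excessEnt w S) Finset.card
    ⟨∅, by simp [excessEnt_empty hw1]⟩
  simp only [Finset.mem_filter, Finset.mem_univ, true_and] at hS hmax
  refine ⟨S, hS.trans (excessEnt_le_univ hw hw1 S), fun i => ?_⟩
  by_cases hi : i ∈ S
  · rw [Finset.insert_eq_of_mem hi, Finset.insert_eq_of_mem (Finset.mem_union_left _ hi)]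
    simpa using hε
  · have h1 := coordEnt_insert_sub_le hw hw1
      (show S ∪ Finset.Iio i ⊆ Finset.univ.erase i from fun j hj => by
        rcases Finset.mem_union.1 hj with h | h
        · simpa using ne_of_mem_of_not_mem h hi
        · simpa using (Finset.mem_Iio.1 h).ne) i
    rw [Finset.insert_erase (Finset.mem_univ i)] at h1
    by_contra! h2
    have h3 : ((insert i S).card : ℝ) * ε ≤ excessEnt w (insert i S) := by
      rw [excessEnt_insert hi, Finset.card_insert_of_notMem hi]
      push_cast
      linarith
    have h4 := hmax _ h3
    rw [Finset.card_insert_of_notMem hi] at h4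
    omega

lemma DTC_eq_excessEnt [∀ i, MeasurableSpace (K i)] [∀ i, MeasurableSingletonClass (K i)]
    (μ : Measure (∀ i, K i)) [IsProbabilityMeasure μ] :
    DTC μ (fun i x => x i) = excessEnt (fun x => μ.real {x}) Finset.univ := by
  have h1 : shEnt μ (joint fun i (x : ∀ i, K i) => x i) =
      coordEnt (fun x => μ.real {x}) Finset.univ := by
    rw [shEnt_eq_weightEnt]
    exact weightEnt_congr fun x x' => by
      simp [joint, funext_iff]
  have h2 : ∀ i : Fin n, shEnt μ (joint fun (j : {j : Fin n // j ≠ i}) (x : ∀ i, K i) => x j.1) =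
      coordEnt (fun x => μ.real {x}) (Finset.univ.erase i) := by
    intro i
    rw [shEnt_eq_weightEnt]
    exact weightEnt_congr fun x x' => by
      simp [joint, funext_iff]
  have h3 : ∀ i : Fin n, shEnt μ (fun x : ∀ i, K i =>
        (x i, joint (fun (j : {j : Fin n // j ≠ i}) (x : ∀ i, K i) => x j.1) x)) =
      coordEnt (fun x => μ.real {x}) Finset.univ := by
    intro i
    rw [shEnt_eq_weightEnt]
    refine weightEnt_congr fun x x' => ?_
    simp only [restrict_eq_restrict_iff, Prod.mk.injEq]
    simp only [joint, funext_iff, Subtype.forall, Finset.mem_univ, true_imp_iff]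
    refine ⟨fun h j => ?_, fun h => ⟨h i, fun j _ => h j⟩⟩
    rcases eq_or_ne j i with rfl | hj
    · exact h.1
    · exact h.2 j hj
  simp only [DTC, condEnt, excessEnt, h1, h2, h3]

end Coordinates

section WeightMeasure

variable {α β : Type*} [Fintype α] [MeasurableSpace α]

/-- The measure on a finite type with the given weights. -/
noncomputable def weightMeasure (v : α → ℝ) : Measure α :=
  ∑ a, ENNReal.ofReal (v a) • Measure.dirac a

lemma weightMeasure_apply [MeasurableSingletonClass α] {v : α → ℝ} (hv : ∀ a, 0 ≤ v a)
    (s : Set α) [DecidablePred (· ∈ s)] :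
    weightMeasure v s = ENNReal.ofReal (∑ a with a ∈ s, v a) := by
  rw [ENNReal.ofReal_sum_of_nonneg fun a _ => hv a, weightMeasure, Measure.finsetSum_apply,
    Finset.sum_filter]
  refine Finset.sum_congr rfl fun a _ => ?_
  rw [Measure.smul_apply, Measure.dirac_apply, smul_eq_mul, Set.indicator_apply]
  simp

lemma weightMeasure_singleton [MeasurableSingletonClass α] {v : α → ℝ} (hv : ∀ a, 0 ≤ v a)
    (a : α) : weightMeasure v {a} = ENNReal.ofReal (v a) := by
  classical
  rw [weightMeasure_apply hv]
  simp [Finset.sum_filter]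

lemma isProbabilityMeasure_weightMeasure {v : α → ℝ} (hv : ∀ a, 0 ≤ v a) (hv1 : ∑ a, v a = 1) :
    IsProbabilityMeasure (weightMeasure v) := by
  constructor
  rw [weightMeasure, Measure.finsetSum_apply]
  simp [← ENNReal.ofReal_sum_of_nonneg fun a _ => hv a, hv1]

lemma integral_weightMeasure [MeasurableSingletonClass α] {v : α → ℝ} (hv : ∀ a, 0 ≤ v a)
    (f : α → ℝ) : ∫ a, f a ∂(weightMeasure v) = ∑ a, v a * f a := by
  rw [weightMeasure, integral_finsetSum_measure fun a _ =>
    (integrable_dirac (by simp)).smul_measure ENNReal.ofReal_ne_top]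
  refine Finset.sum_congr rfl fun a _ => ?_
  rw [integral_smul_measure, integral_dirac, ENNReal.toReal_ofReal (hv a), smul_eq_mul]

lemma map_weightMeasure [MeasurableSingletonClass α] [MeasurableSpace β]
    [MeasurableSingletonClass β] [Fintype β] [DecidableEq β] {v : α → ℝ} (hv : ∀ a, 0 ≤ v a)
    (f : α → β) : (weightMeasure v).map f = weightMeasure fun b => ∑ a with f a = b, v a := by
  refine Measure.ext_of_singleton fun b => ?_
  rw [Measure.map_apply (measurable_of_finite f) (measurableSet_singleton b),
    weightMeasure_singleton fun b => Finset.sum_nonneg fun a _ => hv a]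
  classical
  rw [weightMeasure_apply hv]
  simp

lemma weightMeasure_measureReal [MeasurableSingletonClass α] (μ : Measure α) [IsFiniteMeasure μ] :
    weightMeasure (fun a => μ.real {a}) = μ := by
  refine Measure.ext_of_singleton fun a => ?_
  rw [weightMeasure_singleton fun a => measureReal_nonneg, ofReal_measureReal]

lemma pi_weightMeasure {ι : Type*} [Fintype ι] {K : ι → Type*} [∀ i, Fintype (K i)]
    [∀ i, MeasurableSpace (K i)] [∀ i, MeasurableSingletonClass (K i)] {v : ∀ i, K i → ℝ}
    (hv : ∀ i a, 0 ≤ v i a) [Fintype (∀ i, K i)] :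
    Measure.pi (fun i => weightMeasure (v i)) = weightMeasure fun y => ∏ i, v i (y i) := by
  have : ∀ i, IsFiniteMeasure (weightMeasure (v i)) := by
    intro i
    constructor
    classical
    rw [weightMeasure_apply (hv i)]
    exact ENNReal.ofReal_lt_top
  refine Measure.ext_of_singleton fun y => ?_
  rw [Measure.pi_singleton, weightMeasure_singleton fun y => Finset.prod_nonneg fun i _ => hv i _,
    ENNReal.ofReal_prod_of_nonneg fun i _ => hv i _]
  exact Finset.prod_congr rfl fun i _ => weightMeasure_singleton (hv i) _

end WeightMeasure

section Coupling

variable {n : ℕ} {K : Fin n → Type*} [∀ i, Fintype (K i)] [∀ i, DecidableEq (K i)]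

/-- The conditional law of the `i`-th coordinate given the coordinates in `A`. -/
noncomputable def coordCond (w : (∀ i, K i) → ℝ) (A : Finset (Fin n)) (i : Fin n) (x : ∀ i, K i) :
    K i → ℝ :=
  condWeight w (fun x => x i) (fun x => A.restrict x) x

/-- The law of the `i`-th coordinate of `y` given `x`, when the coordinates are coupled one after
the other, conditionally on the coordinates in `S`. -/
noncomputable def coordKernel (w : (∀ i, K i) → ℝ) (S : Finset (Fin n)) (i : Fin n)
    (x : ∀ i, K i) : K i → ℝ :=
  couplingKernel (coordCond w (S ∪ Finset.Iio i) i x) (coordCond w S i x) (x i)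

variable {w : (∀ i, K i) → ℝ} {S : Finset (Fin n)}

lemma coordCond_nonneg (hw : ∀ x, 0 ≤ w x) (A : Finset (Fin n)) (i : Fin n) (x : ∀ i, K i)
    (a : K i) : 0 ≤ coordCond w A i x a :=
  condWeight_nonneg hw _ _ x a

lemma sum_coordCond (hw : ∀ x, 0 ≤ w x) (A : Finset (Fin n)) (i : Fin n) {x : ∀ i, K i}
    (hx : 0 < w x) : ∑ a, coordCond w A i x a = 1 :=
  sum_condWeight _ _ (hx.trans_le (le_fiberWeight hw _ x))

lemma coordCond_congr {A : Finset (Fin n)} (i : Fin n) {x x' : ∀ i, K i}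
    (h : A.restrict x = A.restrict x') : coordCond w A i x = coordCond w A i x' :=
  condWeight_eq_of_eq h

lemma coordKernel_nonneg (hw : ∀ x, 0 ≤ w x) (i : Fin n) (x : ∀ i, K i) (b : K i) :
    0 ≤ coordKernel w S i x b :=
  couplingKernel_nonneg (coordCond_nonneg hw _ i x) (coordCond_nonneg hw _ i x) _ b

lemma sum_coordKernel (hw : ∀ x, 0 ≤ w x) (i : Fin n) {x : ∀ i, K i} (hx : 0 < w x) :
    ∑ b, coordKernel w S i x b = 1 :=
  sum_couplingKernel (sum_coordCond hw _ i hx) (sum_coordCond hw _ i hx) _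

lemma coordKernel_congr {i : Fin n} {x x' : ∀ i, K i} (hS : S.restrict x = S.restrict x')
    (h : ∀ j ≤ i, x j = x' j) : coordKernel w S i x = coordKernel w S i x' := by
  rw [coordKernel, coordKernel, coordCond_congr i hS, h i le_rfl]
  congr 1
  refine coordCond_congr i ?_
  rw [restrict_eq_restrict_iff] at hS ⊢
  intro j hj
  rcases Finset.mem_union.1 hj with hj | hj
  · exact hS j hj
  · exact h j (Finset.mem_Iio.1 hj).le

/-- Averaging the product of the kernels over `x`, given the coordinates in `S`, gives the product
of the conditional laws. -/
lemma sum_mul_prod_coordKernel (hw : ∀ x, 0 ≤ w x) (y : ∀ i, K i) (s : Finset (Fin n))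
    (G : (∀ i, K i) → ℝ) (hG : ∀ x x', S.restrict x = S.restrict x' → G x = G x') :
    ∑ x, w x * (G x * ∏ i ∈ s, coordKernel w S i x (y i)) =
      ∑ x, w x * (G x * ∏ i ∈ s, coordCond w S i x (y i)) := by
  induction s using Finset.induction_on_max generalizing G with
  | empty => simp
  | insert a s hs ih =>
    have ha : a ∉ s := fun h => lt_irrefl a (hs a h)
    have hres : ∀ {x x' : ∀ i, K i},
        (S ∪ Finset.Iio a).restrict x = (S ∪ Finset.Iio a).restrict x' →
        S.restrict x = S.restrict x' ∧ ∀ j < a, x j = x' j := by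
      intro x x' h
      rw [restrict_eq_restrict_iff] at h ⊢
      exact ⟨fun j hj => h j (Finset.mem_union_left _ hj),
        fun j hj => h j (Finset.mem_union_right _ (Finset.mem_Iio.2 hj))⟩
    have h1 := sum_mul_eq_sum_condWeight hw (fun x => x a)
      (fun x => (S ∪ Finset.Iio a).restrict x)
      (fun x c => (G x * ∏ i ∈ s, coordKernel w S i x (y i)) *
        couplingKernel (coordCond w (S ∪ Finset.Iio a) a x) (coordCond w S a x) c (y a)) (by
          intro x x' h
          obtain ⟨h1, h2⟩ := hres h
          have h3 : ∀ i ∈ s, coordKernel w S i x (y i) = coordKernel w S i x' (y i) :=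
            fun i hi => by
              rw [coordKernel_congr h1 fun j hj => h2 j (hj.trans_lt (hs i hi))]
          simp only [coordCond_congr a h, coordCond_congr a h1, hG x x' h1,
            Finset.prod_congr rfl h3])
    calc ∑ x, w x * (G x * ∏ i ∈ insert a s, coordKernel w S i x (y i))
        = ∑ x, w x * (G x * (∏ i ∈ s, coordKernel w S i x (y i)) *
            couplingKernel (coordCond w (S ∪ Finset.Iio a) a x) (coordCond w S a x) (x a)
              (y a)) := by
          refine Finset.sum_congr rfl fun x _ => ?_
          rw [Finset.prod_insert ha, coordKernel]
          ring
      _ = ∑ x, w x * (G x * coordCond w S a x (y a) *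
            ∏ i ∈ s, coordKernel w S i x (y i)) := by
          rw [h1]
          refine Finset.sum_congr rfl fun x _ => ?_
          rcases (hw x).eq_or_lt with h0 | h0
          · simp [← h0]
          · have h2 := sum_mul_couplingKernel (coordCond_nonneg hw S a x)
              (sum_coordCond hw (S ∪ Finset.Iio a) a h0) (sum_coordCond hw S a h0) (y a)
            refine congrArg (w x * ·) ?_
            rw [← h2, mul_right_comm, Finset.mul_sum]
            refine Finset.sum_congr rfl fun c _ => ?_
            rw [coordCond]
            ring
      _ = ∑ x, w x * (G x * coordCond w S a x (y a) *
            ∏ i ∈ s, coordCond w S i x (y i)) :=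
          ih _ fun x x' h => by rw [hG x x' h, coordCond_congr a h]
      _ = _ := by
          refine Finset.sum_congr rfl fun x _ => ?_
          rw [Finset.prod_insert ha]
          ring

/-- The probability that the `i`-th coordinates differ is controlled by an entropy drop. -/
lemma sq_sum_mul_one_sub_coordKernel_le (hw : ∀ x, 0 ≤ w x) (hw1 : ∑ x, w x = 1) (i : Fin n) :
    ∃ t, ∑ x, w x * (1 - coordKernel w S i x (x i)) ≤ t ∧
      t ^ 2 ≤ (coordEnt w (insert i S) - coordEnt w S) -
        (coordEnt w (insert i (S ∪ Finset.Iio i)) - coordEnt w (S ∪ Finset.Iio i)) := by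
  have hYZ : ∀ x x' : ∀ i, K i, (S ∪ Finset.Iio i).restrict x = (S ∪ Finset.Iio i).restrict x' →
      S.restrict x = S.restrict x' := by
    intro x x' h
    rw [restrict_eq_restrict_iff] at h ⊢
    exact fun j hj => h j (Finset.mem_union_left _ hj)
  refine ⟨_, ?_, by
    have h := sq_sum_condWeight_sub_min_le hw hw1 (fun x => x i) hYZ
    rw [weightEnt_pair_restrict, weightEnt_pair_restrict] at h
    exact h⟩
  have h1 := sum_mul_eq_sum_condWeight hw (fun x => x i)
    (fun x => (S ∪ Finset.Iio i).restrict x)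
    (fun x c => 1 - couplingKernel (coordCond w (S ∪ Finset.Iio i) i x) (coordCond w S i x) c c)
    (fun x x' h => by simp only [coordCond_congr i h, coordCond_congr i (hYZ x x' h)])
  simp only [coordKernel]
  rw [h1]
  exact Finset.sum_le_sum fun x _ => mul_le_mul_of_nonneg_left
    (sum_mul_one_sub_couplingKernel_le (coordCond_nonneg hw _ i x) (coordCond_nonneg hw _ i x))
    (hw x)

lemma sum_prod_coordKernel (hw : ∀ x, 0 ≤ w x) {x : ∀ i, K i} (hx : 0 < w x) :
    ∑ y : ∀ i, K i, ∏ i, coordKernel w S i x (y i) = 1 := by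
  rw [← Fintype.prod_sum fun i b => coordKernel w S i x b]
  exact Finset.prod_eq_one fun i _ => sum_coordKernel hw i hx

lemma sum_prod_coordKernel_ne (hw : ∀ x, 0 ≤ w x) {x : ∀ i, K i} (hx : 0 < w x) (i : Fin n) :
    ∑ y : ∀ i, K i, (∏ j, coordKernel w S j x (y j)) * (if x i ≠ y i then 1 else 0) =
      1 - coordKernel w S i x (x i) := by
  have h : ∀ y : ∀ i, K i,
      (∏ j, coordKernel w S j x (y j)) * (if x i ≠ y i then 1 else 0) =
        ∏ j, coordKernel w S j x (y j) * (if j = i ∧ x j = y j then 0 else 1) := by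
    intro y
    rw [Finset.prod_mul_distrib]
    congr 1
    rw [Finset.prod_eq_single i (fun j _ hj => by simp [hj]) (by simp)]
    by_cases hxy : x i = y i <;> simp [hxy]
  rw [Finset.sum_congr rfl fun y _ => h y,
    ← Fintype.prod_sum fun j b => coordKernel w S j x b * (if j = i ∧ x j = b then 0 else 1),
    Finset.prod_eq_single i (fun j _ hj => by simp [hj, sum_coordKernel hw j hx]) (by simp),
    eq_sub_iff_add_eq]
  have h2 : coordKernel w S i x (x i) =
      ∑ b, coordKernel w S i x b * (if x i = b then 1 else 0) := by simp
  rw [h2, ← Finset.sum_add_distrib]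
  refine Eq.trans ?_ (sum_coordKernel (S := S) hw i hx)
  refine Finset.sum_congr rfl fun b _ => ?_
  by_cases hb : x i = b <;> simp [hb]

lemma sum_prod_coordKernel_mul_hammingDist (hw : ∀ x, 0 ≤ w x) {x : ∀ i, K i} (hx : 0 < w x) :
    ∑ y : ∀ i, K i, (∏ i, coordKernel w S i x (y i)) * hammingDist x y =
      (∑ i, (1 - coordKernel w S i x (x i))) / n := by
  have h : ∀ y : ∀ i, K i, (∏ i, coordKernel w S i x (y i)) * hammingDist x y =
      ∑ i, (∏ j, coordKernel w S j x (y j)) * (if x i ≠ y i then 1 else 0) / n := by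
    intro y
    rw [hammingDist, Finset.card_filter, ← Finset.sum_div, ← Finset.mul_sum]
    push_cast
    ring
  rw [Finset.sum_congr rfl fun y _ => h y, Finset.sum_comm, Finset.sum_div]
  refine Finset.sum_congr rfl fun i _ => ?_
  rw [← Finset.sum_div, sum_prod_coordKernel_ne hw hx]

end Coupling

section Decomposition

variable {n : ℕ} {K : Fin n → Type*} [∀ i, Fintype (K i)] [∀ i, DecidableEq (K i)]
  {w : (∀ i, K i) → ℝ} {S : Finset (Fin n)}

/-- The weights `w` conditioned on the coordinates in `S` agreeing with those of `x₀`. -/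
noncomputable def fiberCond (w : (∀ i, K i) → ℝ) (S : Finset (Fin n)) (x₀ x : ∀ i, K i) : ℝ :=
  if S.restrict x = S.restrict x₀ then
    w x / fiberWeight w (fun x : ∀ i, K i => S.restrict x) x₀ else 0

/-- The sequential coupling of `fiberCond w S x₀` with a product of conditional laws. -/
noncomputable def fiberCoupling (w : (∀ i, K i) → ℝ) (S : Finset (Fin n)) (x₀ : ∀ i, K i)
    (z : (∀ i, K i) × (∀ i, K i)) : ℝ :=
  fiberCond w S x₀ z.1 * ∏ i, coordKernel w S i z.1 (z.2 i)

lemma fiberCond_nonneg (hw : ∀ x, 0 ≤ w x) (x₀ x : ∀ i, K i) : 0 ≤ fiberCond w S x₀ x := by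
  rw [fiberCond]
  split_ifs
  · exact div_nonneg (hw x) (fiberWeight_nonneg hw _ x₀)
  · exact le_rfl

lemma sum_fiberCond (hw : ∀ x, 0 ≤ w x) {x₀ : ∀ i, K i} (hx₀ : 0 < w x₀) :
    ∑ x, fiberCond w S x₀ x = 1 := by
  simp only [fiberCond]
  rw [← Finset.sum_filter, ← Finset.sum_div]
  exact div_self (hx₀.trans_le (le_fiberWeight hw _ x₀)).ne'

lemma fiberCoupling_nonneg (hw : ∀ x, 0 ≤ w x) (x₀ : ∀ i, K i)
    (z : (∀ i, K i) × (∀ i, K i)) : 0 ≤ fiberCoupling w S x₀ z :=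
  mul_nonneg (fiberCond_nonneg hw x₀ z.1)
    (Finset.prod_nonneg fun i _ => coordKernel_nonneg hw i z.1 (z.2 i))

lemma fiberCond_eq_zero {x₀ x : ∀ i, K i} (h : w x = 0) : fiberCond w S x₀ x = 0 := by
  simp [fiberCond, h]

lemma sum_fiberCoupling_right (hw : ∀ x, 0 ≤ w x) (x₀ x : ∀ i, K i) :
    ∑ y, fiberCoupling w S x₀ (x, y) = fiberCond w S x₀ x := by
  simp only [fiberCoupling]
  rw [← Finset.mul_sum]
  rcases (hw x).eq_or_lt with h | h
  · rw [fiberCond_eq_zero h.symm, zero_mul]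
  · rw [sum_prod_coordKernel hw h, mul_one]

lemma sum_fiberCoupling_left (hw : ∀ x, 0 ≤ w x) {x₀ : ∀ i, K i} (hx₀ : 0 < w x₀)
    (y : ∀ i, K i) :
    ∑ x, fiberCoupling w S x₀ (x, y) = ∏ i, coordCond w S i x₀ (y i) := by
  have h := sum_mul_prod_coordKernel (S := S) hw y Finset.univ
    (fun x => if S.restrict x = S.restrict x₀ then
      (fiberWeight w (fun x : ∀ i, K i => S.restrict x) x₀)⁻¹ else 0) (fun x x' h => by rw [h])
  have h1 : ∀ x, fiberCond w S x₀ x = w x * (if S.restrict x = S.restrict x₀ then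
      (fiberWeight w (fun x : ∀ i, K i => S.restrict x) x₀)⁻¹ else 0) := by
    intro x
    rw [fiberCond, mul_ite, mul_zero, div_eq_mul_inv]
  simp only [fiberCoupling, h1, mul_assoc]
  rw [h]
  have h2 : ∀ x, w x * ((if S.restrict x = S.restrict x₀ then
      (fiberWeight w (fun x : ∀ i, K i => S.restrict x) x₀)⁻¹ else 0) *
        ∏ i, coordCond w S i x (y i)) =
      fiberCond w S x₀ x * ∏ i, coordCond w S i x₀ (y i) := by
    intro x
    rw [h1]
    split_ifs with hx
    · simp only [coordCond_congr _ hx, mul_assoc]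
    · simp
  rw [Finset.sum_congr rfl fun x _ => h2 x, ← Finset.sum_mul, sum_fiberCond hw hx₀, one_mul]

lemma fiberWeight_mul_fiberCond (hw : ∀ x, 0 ≤ w x) {x₀ : ∀ i, K i} (hx₀ : 0 < w x₀)
    (x : ∀ i, K i) :
    fiberWeight w (fun x : ∀ i, K i => S.restrict x) x₀ * fiberCond w S x₀ x =
      if S.restrict x = S.restrict x₀ then w x else 0 := by
  have h := (hx₀.trans_le (le_fiberWeight hw (fun x : ∀ i, K i => S.restrict x) x₀)).ne'
  rw [fiberCond]
  split_ifs
  · field_simp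
  · rw [mul_zero]

/-- The total cost of the sequential couplings. -/
lemma sum_mul_sum_prod_coordKernel_mul_hammingDist_lt (hw : ∀ x, 0 ≤ w x) (hw1 : ∑ x, w x = 1)
    {δ : ℝ} (hδ : 0 < δ)
    (hS : ∀ i, (coordEnt w (insert i S) - coordEnt w S) -
        (coordEnt w (insert i (S ∪ Finset.Iio i)) - coordEnt w (S ∪ Finset.Iio i)) < δ ^ 2) :
    ∑ x, w x * ∑ y : ∀ i, K i, (∏ i, coordKernel w S i x (y i)) * hammingDist x y < δ := by
  have h1 : ∀ i, ∑ x, w x * (1 - coordKernel w S i x (x i)) < δ := by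
    intro i
    obtain ⟨t, ht, ht'⟩ := sq_sum_mul_one_sub_coordKernel_le (S := S) hw hw1 i
    exact ht.trans_lt (lt_of_pow_lt_pow_left₀ 2 hδ.le (ht'.trans_lt (hS i)))
  have h2 : ∑ x, w x * ∑ y : ∀ i, K i, (∏ i, coordKernel w S i x (y i)) * hammingDist x y =
      (∑ i, ∑ x, w x * (1 - coordKernel w S i x (x i))) / n := by
    rw [Finset.sum_comm, Finset.sum_div]
    refine Finset.sum_congr rfl fun x _ => ?_
    rcases (hw x).eq_or_lt with h | h
    · simp [← h]
    · rw [sum_prod_coordKernel_mul_hammingDist hw h, ← Finset.mul_sum, mul_div_assoc]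
  rw [h2]
  rcases Nat.eq_zero_or_pos n with rfl | hn
  · simpa using hδ
  · have : NeZero n := ⟨hn.ne'⟩
    rw [div_lt_iff₀ (by exact_mod_cast hn)]
    calc _ < ∑ _i : Fin n, δ :=
          Finset.sum_lt_sum_of_nonempty Finset.univ_nonempty fun i _ => h1 i
      _ = _ := by simp [mul_comm]

end Decomposition

/-- **Theorem A′.** If each `Kᵢ` has cardinality at most `k` and `δ > 0`,
then any probability measure `μ` on `∏ᵢ Kᵢ` can be written as a finite mixture
`μ = p₁μ₁ + ⋯ + p_mμ_m` with `m ≤ k^{DTC(μ)/δ²}`, together with product measures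
`ξ₁, …, ξ_m` and couplings `λⱼ` of `μⱼ` and `ξⱼ` such that `∑ⱼ pⱼ ∫ d_n dλⱼ < δ`. -/
theorem dtc_mixture_of_near_products {n k : ℕ} {K : Fin n → Type*} [∀ i, Fintype (K i)]
    [∀ i, Nonempty (K i)] [∀ i, DecidableEq (K i)]
    [∀ i, MeasurableSpace (K i)] [∀ i, MeasurableSingletonClass (K i)]
    (hcard : ∀ i, Fintype.card (K i) ≤ k)
    (δ : ℝ) (hδ : 0 < δ)
    (μ : Measure (∀ i, K i)) [IsProbabilityMeasure μ] :
    ∃ (m : ℕ) (p : Fin m → ℝ≥0) (μs : Fin m → Measure (∀ i, K i)),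
      (∀ j, IsProbabilityMeasure (μs j)) ∧
      ∑ j, p j = 1 ∧
      μ = ∑ j, (p j : ℝ≥0∞) • μs j ∧
      (m : ℝ) ≤ (k : ℝ) ^ (DTC μ (fun i x => x i) / δ ^ 2) ∧
      ∃ (ξ : Fin m → ∀ i, Measure (K i))
        (lam : Fin m → Measure ((∀ i, K i) × (∀ i, K i))),
        (∀ j i, IsProbabilityMeasure (ξ j i)) ∧
        (∀ j, (lam j).map Prod.fst = μs j) ∧
        (∀ j, (lam j).map Prod.snd = Measure.pi (ξ j)) ∧
        ∑ j, (p j : ℝ) * ∫ x, hammingDist x.1 x.2 ∂(lam j) < δ := by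
  classical
  set w : (∀ i, K i) → ℝ := fun x => μ.real {x} with hwdef
  have hw : ∀ x, 0 ≤ w x := fun x => measureReal_nonneg
  have hw1 : ∑ x, w x = 1 := by
    rw [hwdef, sum_measureReal_singleton, Finset.coe_univ, probReal_univ]
  obtain ⟨S, hScard, hS⟩ := exists_finset_coordEnt_sub_lt hw hw1 (sq_pos_of_pos hδ)
  obtain ⟨x₁, hx₁⟩ : ∃ x, 0 < w x := by
    by_contra! h
    linarith [Finset.sum_nonpos fun x (_ : x ∈ Finset.univ) => h x]
  set Z : (∀ i, K i) → ∀ i : S, K i := fun x => S.restrict x with hZ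
  have hrep : ∀ z : ∀ i : S, K i, ∃ x, 0 < w x ∧ ((∃ x', 0 < w x' ∧ Z x' = z) → Z x = z) := by
    intro z
    by_cases h : ∃ x', 0 < w x' ∧ Z x' = z
    · obtain ⟨x', hx', hz⟩ := h
      exact ⟨x', hx', fun _ => hz⟩
    · exact ⟨x₁, hx₁, fun h' => absurd h' h⟩
  choose rep hrep_pos hrep_eq using hrep
  set P : (∀ i : S, K i) → ℝ := fun z => ∑ x with Z x = z, w x with hP
  have hP0 : ∀ z, 0 ≤ P z := fun z => Finset.sum_nonneg fun x _ => hw x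
  have hPsum : ∑ z, P z = 1 := by rw [← hw1]; exact Finset.sum_fiberwise _ _ _
  have hPcond : ∀ z x, P z * fiberCond w S (rep z) x = if Z x = z then w x else 0 := by
    intro z x
    by_cases h : ∃ x', 0 < w x' ∧ Z x' = z
    · have hz := hrep_eq z h
      have h1 := fiberWeight_mul_fiberCond (S := S) hw (hrep_pos z) x
      change fiberWeight w Z (rep z) * _ = if Z x = Z (rep z) then w x else 0 at h1
      rw [fiberWeight, hz] at h1
      exact h1
    · push Not at h
      have h0 : ∀ x, Z x = z → w x = 0 := fun x hx =>
        ((hw x).eq_or_lt.resolve_right fun h' => h x h' hx).symm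
      have hPz : P z = 0 := Finset.sum_eq_zero fun x hx => h0 x (by simpa using hx)
      rw [hPz, zero_mul]
      split_ifs with hx
      · exact (h0 x hx).symm
      · rfl
  set e := Fintype.equivFin (∀ i : S, K i) with he
  refine ⟨Fintype.card (∀ i : S, K i), fun j => (P (e.symm j)).toNNReal,
    fun j => weightMeasure (fiberCond w S (rep (e.symm j))),
    fun j => isProbabilityMeasure_weightMeasure (fiberCond_nonneg hw _)
      (sum_fiberCond hw (hrep_pos _)), ?_, ?_, ?_,
    fun j i => weightMeasure (coordCond w S i (rep (e.symm j))),
    fun j => weightMeasure (fiberCoupling w S (rep (e.symm j))), ?_, ?_, ?_, ?_⟩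
  · rw [e.symm.sum_comp fun z => (P z).toNNReal, ← Real.toNNReal_sum_of_nonneg fun z _ => hP0 z,
      hPsum, Real.toNNReal_one]
  · rw [e.symm.sum_comp fun z => ((P z).toNNReal : ℝ≥0∞) • weightMeasure (fiberCond w S (rep z))]
    refine Measure.ext_of_singleton fun x => ?_
    rw [Measure.finsetSum_apply]
    have h : ∀ z, (((P z).toNNReal : ℝ≥0∞) • weightMeasure (fiberCond w S (rep z))) {x} =
        if Z x = z then ENNReal.ofReal (w x) else 0 := by
      intro z
      rw [Measure.smul_apply, weightMeasure_singleton (fiberCond_nonneg hw _), smul_eq_mul]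
      change ENNReal.ofReal (P z) * _ = _
      rw [← ENNReal.ofReal_mul (hP0 z), hPcond]
      split_ifs <;> simp
    rw [Finset.sum_congr rfl fun z _ => h z]
    simp [hwdef]
  · rw [Fintype.card_pi, DTC_eq_excessEnt]
    have h1 : (∏ i : S, Fintype.card (K i) : ℕ) ≤ k ^ S.card := by
      refine (Finset.prod_le_pow_card Finset.univ (fun i : S => Fintype.card (K i)) k
        fun i _ => hcard i).trans ?_
      simp
    have h2 : (S.card : ℝ) ≤ excessEnt w Finset.univ / δ ^ 2 :=
      (le_div_iff₀ (sq_pos_of_pos hδ)).2 hScard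
    rcases Nat.eq_zero_or_pos n with rfl | hn
    · have hS0 : S = ∅ := Subsingleton.elim _ _
      rw [Subsingleton.elim (Finset.univ : Finset (Fin 0)) ∅, excessEnt_empty hw1]
      subst hS0
      simp
    · have hk : 1 ≤ k := (Fintype.card_pos (α := K ⟨0, hn⟩)).trans_le (hcard _)
      calc ((∏ i : S, Fintype.card (K i) : ℕ) : ℝ) ≤ (k : ℝ) ^ S.card := by exact_mod_cast h1
        _ = (k : ℝ) ^ (S.card : ℝ) := (Real.rpow_natCast _ _).symm
        _ ≤ _ := Real.rpow_le_rpow_of_exponent_le (by exact_mod_cast hk) h2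
  · exact fun j i => isProbabilityMeasure_weightMeasure (coordCond_nonneg hw S i _)
      (sum_coordCond hw S i (hrep_pos _))
  · intro j
    rw [map_weightMeasure (fiberCoupling_nonneg hw _)]
    congr 1
    funext x
    rw [← sum_fiberCoupling_right hw, Finset.sum_filter, Fintype.sum_prod_type,
      Finset.sum_eq_single x (fun x' _ h => by simp [h]) (by simp)]
    simp
  · intro j
    rw [map_weightMeasure (fiberCoupling_nonneg hw _),
      pi_weightMeasure fun i => coordCond_nonneg hw S i _]
    congr 1
    funext y
    rw [← sum_fiberCoupling_left hw (hrep_pos _), Finset.sum_filter, Fintype.sum_prod_type]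
    simp
  · rw [e.symm.sum_comp fun z => ((P z).toNNReal : ℝ) *
      ∫ x, hammingDist x.1 x.2 ∂(weightMeasure (fiberCoupling w S (rep z)))]
    refine lt_of_eq_of_lt ?_ (sum_mul_sum_prod_coordKernel_mul_hammingDist_lt hw hw1 hδ hS)
    have h : ∀ z, ((P z).toNNReal : ℝ) *
        ∫ x, hammingDist x.1 x.2 ∂(weightMeasure (fiberCoupling w S (rep z))) =
        ∑ x, if Z x = z then
          w x * ∑ y : ∀ i, K i, (∏ i, coordKernel w S i x (y i)) * hammingDist x y else 0 := by
      intro z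
      rw [integral_weightMeasure (fiberCoupling_nonneg hw _), Real.coe_toNNReal _ (hP0 z),
        Fintype.sum_prod_type, Finset.mul_sum]
      refine Finset.sum_congr rfl fun x _ => ?_
      simp only [fiberCoupling, mul_assoc]
      rw [← Finset.mul_sum, ← mul_assoc, hPcond, ite_mul, zero_mul]
    rw [Finset.sum_congr rfl fun z _ => h z, Finset.sum_comm]
    simp

end Corr
end
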